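/- Let (F, φ) be a TC flow on D² such that, in the standard coordinates, the derivative of F at O is DF(O) = [[0, a],[0, 0]] for some real a ≠ 0. Assume that every h ∈ E(F) whose Jacobian matrix at O is the identity belongs to Sh(F) (i.e. ker j ⊆ Sh(F)). Then for every h ∈ E⁺(F): h ∈ Sh(F) if and only if the Jacobian matrix of h at O has the form [[1, d],[0, 1]] for some d ∈ ℝ. That is, Sh(F) = j⁻¹(A⁺), where A⁺ = {[[1, d],[0, 1]] : d ∈ ℝ} and j assigns to a map its Jacobian matrix at O. -/

import Mathlib

open Set

noncomputable section

/-- Points of the plane. -/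
abbrev Pt : Type := ℝ × ℝ

/-- The closed unit disk `D² = {x² + y² ≤ 1}`. -/
def diskD : Set Pt := {p | p.1 ^ 2 + p.2 ^ 2 ≤ 1}

/-- The origin `O = (0,0)`. -/
def ptO : Pt := (0, 0)

/-- The boundary circle `∂D² = {x² + y² = 1}`. -/
def bdD : Set Pt := {p | p.1 ^ 2 + p.2 ^ 2 = 1}

/-- A TC ("topological center") flow on the disk `D²`: a `C^∞` vector field `F` on `D²`
together with its flow `φ`, such that `O` is the unique singular point of `F` in `D²`,
the boundary circle is an orbit, and every nonsingular point is periodic. -/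
structure TCFlow where
  /-- the vector field -/
  F : Pt → Pt
  /-- the flow of `F` -/
  φ : Pt → ℝ → Pt
  F_smooth : ContDiffOn ℝ (⊤ : ℕ∞) F diskD
  φ_smooth : ContDiffOn ℝ (⊤ : ℕ∞) (fun p : Pt × ℝ => φ p.1 p.2) (diskD ×ˢ (univ : Set ℝ))
  φ_mapsTo : ∀ z ∈ diskD, ∀ t : ℝ, φ z t ∈ diskD
  φ_zero : ∀ z ∈ diskD, φ z 0 = z
  φ_add : ∀ z ∈ diskD, ∀ s t : ℝ, φ (φ z s) t = φ z (s + t)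
  φ_deriv : ∀ z ∈ diskD, ∀ t : ℝ, HasDerivAt (φ z) (F (φ z t)) t
  F_zero_iff : ∀ z ∈ diskD, (F z = 0 ↔ z = ptO)
  bd_orbit : ∀ z ∈ bdD, {p : Pt | ∃ t : ℝ, φ z t = p} = bdD
  periodic : ∀ z ∈ diskD, z ≠ ptO → ∃ t : ℝ, 0 < t ∧ φ z t = z

/-- The orbit of a point under the flow. -/
def orb (Φ : TCFlow) (z : Pt) : Set Pt := Set.range (Φ.φ z)

/-- `h ∈ E(F)`: a `C^∞` self-map of `D²` preserving each orbit of `F` and restricting to a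
`C^∞` diffeomorphism between some open neighbourhoods of `O` in `D²`. -/
def Emem (Φ : TCFlow) (h : Pt → Pt) : Prop :=
  Set.MapsTo h diskD diskD ∧
  ContDiffOn ℝ (⊤ : ℕ∞) h diskD ∧
  (∀ z ∈ diskD, h '' orb Φ z = orb Φ z) ∧
  (∃ U V : Set Pt, IsOpen U ∧ IsOpen V ∧ ptO ∈ U ∧ ptO ∈ V ∧ U ⊆ diskD ∧ V ⊆ diskD ∧
    Set.BijOn h U V ∧
    ∃ g : Pt → Pt, ContDiffOn ℝ (⊤ : ℕ∞) g V ∧ ∀ z ∈ U, g (h z) = z)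

/-- `h ∈ E⁺(F)`: an element of `E(F)` with positive Jacobian determinant at `O`. -/
def EplMem (Φ : TCFlow) (h : Pt → Pt) : Prop :=
  Emem Φ h ∧ 0 < LinearMap.det ((fderiv ℝ h ptO) : Pt →ₗ[ℝ] Pt)

/-- `h ∈ E^∂(F)`: an element of `E⁺(F)` fixed on the boundary circle. -/
def EbdMem (Φ : TCFlow) (h : Pt → Pt) : Prop :=
  EplMem Φ h ∧ ∀ z ∈ bdD, h z = z

/-- `h ∈ D(F)`: an element of `E(F)` which is a `C^∞` diffeomorphism of `D²` onto itself. -/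
def DmemTC (Φ : TCFlow) (h : Pt → Pt) : Prop :=
  Emem Φ h ∧ Set.BijOn h diskD diskD ∧
  ∃ g : Pt → Pt, ContDiffOn ℝ (⊤ : ℕ∞) g diskD ∧
    (∀ z ∈ diskD, g (h z) = z) ∧ (∀ z ∈ diskD, h (g z) = z)

/-- `h ∈ D⁺(F) = D(F) ∩ E⁺(F)`. -/
def DplMem (Φ : TCFlow) (h : Pt → Pt) : Prop := DmemTC Φ h ∧ EplMem Φ h

/-- `h ∈ D^∂(F) = D(F) ∩ E^∂(F)`. -/
def DbdMem (Φ : TCFlow) (h : Pt → Pt) : Prop := DmemTC Φ h ∧ EbdMem Φ h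

/-- `h ∈ Sh(F)`: `h` is the shift along orbits of `F` via some `C^∞` function
`α : D² → ℝ`. -/
def ShMem (Φ : TCFlow) (h : Pt → Pt) : Prop :=
  ∃ α : Pt → ℝ, ContDiffOn ℝ (⊤ : ℕ∞) α diskD ∧ ∀ z ∈ diskD, h z = Φ.φ z (α z)

/-- A first strong integral for a TC flow: a continuous function `f : D² → [0,1]`, `C^∞`
and without critical points on `D² ∖ {O}`, with `f⁻¹(0) = {O}`, `f⁻¹(1) = ∂D²`, and whose
level sets are exactly the orbits of the flow. -/
def FirstStrongIntegral (Φ : TCFlow) (f : Pt → ℝ) : Prop :=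
  ContinuousOn f diskD ∧
  Set.MapsTo f diskD (Icc (0 : ℝ) 1) ∧
  ContDiffOn ℝ (⊤ : ℕ∞) f (diskD \ {ptO}) ∧
  (∀ z ∈ diskD \ {ptO}, fderivWithin ℝ f (diskD \ {ptO}) z ≠ 0) ∧
  (∀ z ∈ diskD, (f z = 0 ↔ z = ptO)) ∧
  (∀ z ∈ diskD, (f z = 1 ↔ z ∈ bdD)) ∧
  (∀ c ∈ Icc (0 : ℝ) 1, ∃ z ∈ diskD, {w ∈ diskD | f w = c} = orb Φ z)

/-- `θ` is the minimal period function of the TC flow `Φ` on `D² ∖ {O}`. -/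
def IsMinPeriod (Φ : TCFlow) (θ : Pt → ℝ) : Prop :=
  ∀ z ∈ diskD \ {ptO},
    0 < θ z ∧ Φ.φ z (θ z) = z ∧ ∀ t : ℝ, 0 < t → t < θ z → Φ.φ z t ≠ z

def diskB : Set Pt := {p | p.1 ^ 2 + p.2 ^ 2 < 1}

theorem diskB_open : IsOpen diskB := by
  apply isOpen_lt <;> fun_prop

theorem diskB_sub : diskB ⊆ diskD := by
  intro p hp
  simp only [diskB, diskD, mem_setOf_eq] at *
  exact hp.le

theorem ptO_B : ptO ∈ diskB := by simp [ptO, diskB]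

theorem ptO_D : ptO ∈ diskD := diskB_sub ptO_B

theorem B_nhds {z : Pt} (hz : z ∈ diskB) : diskD ∈ nhds z :=
  Filter.mem_of_superset (diskB_open.mem_nhds hz) diskB_sub

theorem D_nhds : diskD ∈ nhds ptO := B_nhds ptO_B

def PP (Φ : TCFlow) : Pt × ℝ → Pt := fun p => Φ.φ p.1 p.2

theorem PP_cd (Φ : TCFlow) {z : Pt} (hz : z ∈ diskB) (t : ℝ) :
    ContDiffAt ℝ (⊤ : ℕ∞) (PP Φ) (z, t) :=
  Φ.φ_smooth.contDiffAt (prod_mem_nhds (B_nhds hz) Filter.univ_mem)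

theorem PP_diff (Φ : TCFlow) {z : Pt} (hz : z ∈ diskB) (t : ℝ) :
    DifferentiableAt ℝ (PP Φ) (z, t) :=
  (PP_cd Φ hz t).differentiableAt (by simp)

theorem F_O (Φ : TCFlow) : Φ.F ptO = 0 := (Φ.F_zero_iff ptO ptO_D).2 rfl

theorem phi_z (Φ : TCFlow) {z : Pt} (hz : z ∈ diskB) (t : ℝ) :
    HasFDerivAt (fun w => Φ.φ w t)
      ((fderiv ℝ (PP Φ) (z, t)).comp (ContinuousLinearMap.inl ℝ Pt ℝ)) z := by
  have h1 := (PP_diff Φ hz t).hasFDerivAt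
  have h2 : HasFDerivAt (fun e : Pt => (e, t)) (ContinuousLinearMap.inl ℝ Pt ℝ) z :=
    hasFDerivAt_prodMk_left z t
  exact HasFDerivAt.comp (f := fun e : Pt => (e, t)) z h1 h2

theorem phi_O (Φ : TCFlow) (t : ℝ) : Φ.φ ptO t = ptO := by
  have key : ∀ s, HasDerivAt (Φ.φ ptO) 0 s := by
    intro s
    have h1 : HasDerivAt (fun t => Φ.φ ptO (t + s)) (Φ.F (Φ.φ ptO s)) 0 := by
      have := Φ.φ_deriv ptO ptO_D (0 + s)
      have := this.comp_add_const 0 s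
      simpa using this
    have h2 : HasDerivAt (fun t => Φ.φ ptO (t + s)) 0 0 := by
      have e : (fun t => Φ.φ ptO (t + s)) = fun t => Φ.φ (Φ.φ ptO t) s := by
        funext t; rw [Φ.φ_add _ ptO_D]
      rw [e]
      have h3 := Φ.φ_deriv ptO ptO_D 0
      have h4 := phi_z Φ ptO_B s
      rw [← Φ.φ_zero ptO ptO_D] at h4
      have h5 := h4.comp_hasDerivAt (0:ℝ) h3
      rw [Φ.φ_zero ptO ptO_D, F_O, map_zero] at h5
      exact h5
    have h6 := h1.unique h2
    have h7 := Φ.φ_deriv ptO ptO_D s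
    rwa [h6] at h7
  have := is_const_of_deriv_eq_zero (fun s => (key s).differentiableAt) (fun s => (key s).deriv) t 0
  rw [this, Φ.φ_zero _ ptO_D]

theorem L_deriv (Φ : TCFlow) (v : Pt) (t : ℝ) :
    HasDerivAt (fun t => fderiv ℝ (PP Φ) (ptO, t) (v, 0))
      (fderiv ℝ Φ.F ptO (fderiv ℝ (PP Φ) (ptO, t) (v, 0))) t := by
  have hc := PP_cd Φ ptO_B t
  have hsym : IsSymmSndFDerivAt ℝ (PP Φ) (ptO, t) := by
    apply hc.isSymmSndFDerivAt
    simp only [minSmoothness_of_isRCLikeNormedField]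
    exact WithTop.coe_le_coe.2 le_top
  have hd : HasFDerivAt (fderiv ℝ (PP Φ)) (fderiv ℝ (fderiv ℝ (PP Φ)) (ptO, t)) (ptO, t) := by
    have : ContDiffAt ℝ 1 (fderiv ℝ (PP Φ)) (ptO, t) :=
      hc.fderiv_right (WithTop.coe_le_coe.2 le_top)
    exact (this.differentiableAt (by simp)).hasFDerivAt
  have h1 : HasDerivAt (fun t => fderiv ℝ (PP Φ) (ptO, t) (v, 0))
      (fderiv ℝ (fderiv ℝ (PP Φ)) (ptO, t) (0, 1) (v, 0)) t := by
    have := hd.comp_hasDerivAt t ((hasDerivAt_const t ptO).prodMk (hasDerivAt_id t))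
    exact this.clm_apply (hasDerivAt_const t ((v, 0) : Pt × ℝ)) |>.congr_deriv (by simp)
  have h2 : HasFDerivAt (fun z => fderiv ℝ (PP Φ) (z, t) (0, 1))
      ((((fderiv ℝ (fderiv ℝ (PP Φ)) (ptO, t)).comp (ContinuousLinearMap.inl ℝ Pt ℝ))).flip (0, 1)) ptO := by
    have h2 : HasFDerivAt (fun e : Pt => (e, t)) (ContinuousLinearMap.inl ℝ Pt ℝ) ptO :=
      hasFDerivAt_prodMk_left ptO t
    have := HasFDerivAt.comp (f := fun e : Pt => (e, t)) ptO hd h2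
    have := this.clm_apply (hasFDerivAt_const ((0, 1) : Pt × ℝ) ptO)
    exact this.congr_fderiv (by ext <;> simp)
  have h3 : HasFDerivAt (fun z => fderiv ℝ (PP Φ) (z, t) (0, 1))
      ((fderiv ℝ Φ.F ptO).comp
        ((fderiv ℝ (PP Φ) (ptO, t)).comp (ContinuousLinearMap.inl ℝ Pt ℝ))) ptO := by
    have hF : HasFDerivAt Φ.F (fderiv ℝ Φ.F ptO) (Φ.φ ptO t) := by
      rw [phi_O]
      exact ((Φ.F_smooth.contDiffAt D_nhds).differentiableAt (by simp)).hasFDerivAt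
    have := HasFDerivAt.comp ptO hF (phi_z Φ ptO_B t)
    refine this.congr_of_eventuallyEq ?_
    filter_upwards [diskB_open.mem_nhds ptO_B] with z hz
    have a1 := (PP_diff Φ hz t).hasFDerivAt.comp_hasDerivAt t
      ((hasDerivAt_const t z).prodMk (hasDerivAt_id t))
    exact a1.unique (Φ.φ_deriv z (diskB_sub hz) t)
  have h4 := congrArg (fun (l : Pt →L[ℝ] Pt) => l v) (h2.unique h3)
  simp at h4
  rw [hsym.eq, h4] at h1
  exact h1

theorem L_eq (Φ : TCFlow) (a : ℝ) (hDF : ∀ v : Pt, fderiv ℝ Φ.F ptO v = (a * v.2, 0))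
    (v : Pt) (t : ℝ) : fderiv ℝ (PP Φ) (ptO, t) (v, 0) = (v.1 + a * t * v.2, v.2) := by
  have h0 : fderiv ℝ (PP Φ) (ptO, 0) (v, 0) = v := by
    have h1 := phi_z Φ ptO_B 0
    have h2 : HasFDerivAt (fun w => Φ.φ w 0) (ContinuousLinearMap.id ℝ Pt) ptO := by
      refine (hasFDerivAt_id ptO).congr_of_eventuallyEq ?_
      filter_upwards [D_nhds] with z hz
      exact Φ.φ_zero z hz
    have h4 := congrArg (fun (l : Pt →L[ℝ] Pt) => l v) (h1.unique h2)
    simpa using h4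
  set L : ℝ → Pt := fun t => fderiv ℝ (PP Φ) (ptO, t) (v, 0) with hL
  have hd : ∀ t, HasDerivAt L (a * (L t).2, 0) t := by
    intro t
    have := L_deriv Φ v t
    rwa [hDF] at this
  have d2 : ∀ t, HasDerivAt (fun t => (L t).2) 0 t := fun t =>
    (hasFDerivAt_snd (𝕜 := ℝ) (p := L t)).comp_hasDerivAt t (hd t)
  have d1 : ∀ t, HasDerivAt (fun t => (L t).1) (a * (L t).2) t := fun t =>
    (hasFDerivAt_fst (𝕜 := ℝ) (p := L t)).comp_hasDerivAt t (hd t)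
  have c2 : ∀ t, (L t).2 = v.2 := by
    intro t
    have := is_const_of_deriv_eq_zero (fun s => (d2 s).differentiableAt) (fun s => (d2 s).deriv) t 0
    have h0' : L 0 = v := h0
    simpa [h0'] using this
  have d3 : ∀ t, HasDerivAt (fun t => (L t).1 - t * (a * v.2)) 0 t := by
    intro t
    have := (d1 t).sub ((hasDerivAt_id t).mul_const (a * v.2))
    rw [c2, one_mul, sub_self] at this
    exact this
  have c1 := is_const_of_deriv_eq_zero (fun s => (d3 s).differentiableAt) (fun s => (d3 s).deriv) t 0
  have h0' : L 0 = v := h0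
  simp only [h0'] at c1
  change L t = _
  ext
  · simp; linarith
  · exact c2 t

theorem h_O (Φ : TCFlow) (h : Pt → Pt) (hh : Emem Φ h) : h ptO = ptO := by
  have := hh.2.2.1 ptO ptO_D
  have e : orb Φ ptO = {ptO} := by
    have : Φ.φ ptO = fun _ => ptO := funext (phi_O Φ)
    rw [orb, this, Set.range_const]
  rw [e] at this
  simpa using this

theorem phit_cd (Φ : TCFlow) (t : ℝ) : ContDiffOn ℝ (⊤ : ℕ∞) (fun z => Φ.φ z t) diskD := by
  have : ContDiffOn ℝ (⊤ : ℕ∞) (fun z : Pt => (z, t)) diskD := by fun_prop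
  exact Φ.φ_smooth.comp this (fun z hz => ⟨hz, mem_univ _⟩)

theorem Emem_comp (Φ : TCFlow) (h : Pt → Pt) (hh : Emem Φ h) (t : ℝ) :
    Emem Φ (fun z => Φ.φ (h z) t) := by
  have hO := h_O Φ h hh
  obtain ⟨hm, hs, ho, U, V, hU, hV, hOU, hOV, hUD, hVD, hb, g, hg, hgh⟩ := hh
  have hsm : ContDiffOn ℝ (⊤ : ℕ∞) (fun z => Φ.φ (h z) t) diskD := (phit_cd Φ t).comp hs hm
  have inv1 : ∀ z ∈ diskD, Φ.φ (Φ.φ z t) (-t) = z := fun z hz => by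
    rw [Φ.φ_add z hz, add_neg_cancel, Φ.φ_zero z hz]
  have inv2 : ∀ z ∈ diskD, Φ.φ (Φ.φ z (-t)) t = z := fun z hz => by
    rw [Φ.φ_add z hz, neg_add_cancel, Φ.φ_zero z hz]
  refine ⟨fun z hz => Φ.φ_mapsTo _ (hm hz) _, hsm, ?_, ?_⟩
  · intro z hz
    have : (fun z => Φ.φ (h z) t) '' orb Φ z = (fun w => Φ.φ w t) '' (h '' orb Φ z) := by
      rw [Set.image_image]
    rw [this, ho z hz]
    ext w
    constructor
    · rintro ⟨_, ⟨s, rfl⟩, rfl⟩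
      exact ⟨s + t, (Φ.φ_add z hz s t).symm⟩
    · rintro ⟨s, rfl⟩
      exact ⟨_, ⟨s - t, rfl⟩, by simp [Φ.φ_add z hz]⟩
  · refine ⟨U ∩ (fun z => Φ.φ (h z) t) ⁻¹' diskB, diskB ∩ (fun z => Φ.φ z (-t)) ⁻¹' V,
      (hsm.continuousOn.mono hUD).isOpen_inter_preimage hU diskB_open,
      ((phit_cd Φ (-t)).continuousOn.mono diskB_sub).isOpen_inter_preimage diskB_open hV,
      ⟨hOU, ?_⟩, ⟨ptO_B, ?_⟩, fun z hz => hUD hz.1, fun z hz => diskB_sub hz.1, ?_,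
      fun z => g (Φ.φ z (-t)), ?_, ?_⟩
    · simp only [mem_preimage, hO, phi_O]; exact ptO_B
    · simp only [mem_preimage, phi_O]; exact hOV
    · refine ⟨?_, ?_, ?_⟩
      · intro z hz
        refine ⟨hz.2, ?_⟩
        simp only [mem_preimage]
        rw [inv1 _ (hm (hUD hz.1))]
        exact hb.mapsTo hz.1
      · intro z hz w hw e
        have e' := congrArg (fun x => Φ.φ x (-t)) e
        simp only at e'
        rw [inv1 _ (hm (hUD hz.1)), inv1 _ (hm (hUD hw.1))] at e'
        exact hb.injOn hz.1 hw.1 e'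
      · rintro w ⟨hw, hw'⟩
        obtain ⟨u, hu, e⟩ := hb.surjOn hw'
        have : Φ.φ (h u) t = w := by rw [e]; exact inv2 w (diskB_sub hw)
        refine ⟨u, ⟨hu, ?_⟩, this⟩
        simp only [mem_preimage, this]; exact hw
    · exact hg.comp ((phit_cd Φ (-t)).mono fun z hz => diskB_sub hz.1) (fun z hz => hz.2)
    · intro z hz
      simp only
      rw [inv1 _ (hm (hUD hz.1)), hgh z hz.1]

/-- if `DF(O) = [[0,a],[0,0]]` with `a ≠ 0` and `ker j ⊆ Sh(F)`, then an
element `h ∈ E⁺(F)` lies in `Sh(F)` iff its Jacobi matrix at `O` has the form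
`[[1,d],[0,1]]`; that is, `Sh(F) = j⁻¹(A⁺)`. -/
theorem ShMem_iff_jet_unipotent
    (Φ : TCFlow) (a : ℝ) (ha : a ≠ 0)
    (hDF : ∀ v : Pt, fderiv ℝ Φ.F ptO v = (a * v.2, 0))
    (hker : ∀ h : Pt → Pt, Emem Φ h →
      fderiv ℝ h ptO = ContinuousLinearMap.id ℝ Pt → ShMem Φ h)
    (h : Pt → Pt) (hh : EplMem Φ h) :
    ShMem Φ h ↔ ∃ d : ℝ, ∀ v : Pt, fderiv ℝ h ptO v = (v.1 + d * v.2, v.2) := by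
  obtain ⟨hE, -⟩ := hh
  have hO := h_O Φ h hE
  have hhd : HasFDerivAt h (fderiv ℝ h ptO) ptO :=
    ((hE.2.1.contDiffAt D_nhds).differentiableAt (by simp)).hasFDerivAt
  constructor
  · rintro ⟨α, hα, hz⟩
    refine ⟨a * α ptO, fun v => ?_⟩
    have hαd := ((hα.contDiffAt D_nhds).differentiableAt (by simp)).hasFDerivAt
    have h1 := HasFDerivAt.comp ptO (PP_diff Φ ptO_B (α ptO)).hasFDerivAt
      ((hasFDerivAt_id ptO).prodMk hαd)
    have h2 : HasFDerivAt h _ ptO := h1.congr_of_eventuallyEq (by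
      filter_upwards [D_nhds] with z hz'
      exact hz z hz')
    rw [h2.fderiv]
    have h3 : fderiv ℝ (PP Φ) (ptO, α ptO) ((0 : Pt), (1 : ℝ)) = 0 := by
      have a1 := (PP_diff Φ ptO_B (α ptO)).hasFDerivAt.comp_hasDerivAt (α ptO)
        ((hasDerivAt_const (α ptO) ptO).prodMk (hasDerivAt_id (α ptO)))
      rw [a1.unique (Φ.φ_deriv ptO ptO_D (α ptO)), phi_O, F_O]
    have h4 : ((v, fderiv ℝ α ptO v) : Pt × ℝ)
        = (v, 0) + (fderiv ℝ α ptO v) • ((0 : Pt), (1 : ℝ)) := by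
      ext <;> simp
    change fderiv ℝ (PP Φ) (ptO, α ptO) (v, fderiv ℝ α ptO v) = _
    rw [h4, map_add, map_smul, h3, smul_zero, add_zero, L_eq Φ a hDF]
  · rintro ⟨d, hd⟩
    obtain ⟨β, hβ, hz⟩ := hker _ (Emem_comp Φ h hE (-(d / a))) (by
      have h1 := phi_z Φ ptO_B (-(d / a))
      rw [← hO] at h1
      have h2 := HasFDerivAt.comp ptO h1 hhd
      have h3 := h2.fderiv
      rw [hO] at h3
      refine h3.trans ?_
      apply ContinuousLinearMap.ext
      intro v
      simp only [ContinuousLinearMap.comp_apply, ContinuousLinearMap.inl_apply, hd, L_eq Φ a hDF,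
        ContinuousLinearMap.id_apply]
      ext
      · simp only; field_simp; ring
      · rfl)
    refine ⟨fun z => β z + d / a, hβ.add contDiffOn_const, fun z hzD => ?_⟩
    have := congrArg (fun w => Φ.φ w (d / a)) (hz z hzD)
    simp only at this
    rw [Φ.φ_add _ (hE.1 hzD), Φ.φ_add _ hzD, neg_add_cancel, Φ.φ_zero _ (hE.1 hzD)] at this
    exact this

end
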